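/- Let n ≥ 1 be an integer and let α satisfy 0 < α < 1. Let u_n = 1 and, for each i = 0,…,n−1, let u_i ∈ (0,1) satisfy the Clopper–Pearson upper-endpoint equation Σ_{x=0}^{i} B(n,x,u_i) = α. Then 0 < u_0 < u_1 < ⋯ < u_n = 1 and the coverage satisfies C_u(p) ≥ 1−α for every p ∈ (0,1], where C_u(p) = Σ_{x=i}^n B(n,x,p) for the smallest index i with p ≤ u_i. Consequently the Clopper–Pearson upper-tail intervals are LCC intervals: ∫_{u_{i−1}}^{u_i} Σ_{x=i}^n B(n,x,p) dp ≥ (1−α)(u_i − u_{i−1}) for every i = 1,…,n. -/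

import Mathlib

open MeasureTheory

/-- The binomial probability mass function: `B n x p = C(n,x) p^x (1-p)^(n-x)`. -/
noncomputable def B (n x : ℕ) (p : ℝ) : ℝ :=
  (n.choose x : ℝ) * p ^ x * (1 - p) ^ (n - x)

/-- A sequence `0 < u 0 < u 1 < ⋯ < u n = 1` of OLC upper endpoints at level `1 - α`:
each inter-spike average coverage equals the nominal level. -/
def IsOLCUpper (n : ℕ) (α : ℝ) (u : ℕ → ℝ) : Prop :=
  0 < u 0 ∧ (∀ i, i < n → u i < u (i + 1)) ∧ u n = 1 ∧
    ∀ i, 1 ≤ i → i ≤ n →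
      (∫ p in (u (i - 1))..(u i), ∑ x ∈ Finset.Icc i n, B n x p)
        = (1 - α) * (u i - u (i - 1))

/-- A sequence `0 < v 0 < v 1 < ⋯ < v n = 1` giving upper-tail locally correct confidence
(LCC) intervals at level `1 - α`: each inter-spike average coverage is at least the
nominal level. -/
def IsLCCUpper (n : ℕ) (α : ℝ) (v : ℕ → ℝ) : Prop :=
  0 < v 0 ∧ (∀ i, i < n → v i < v (i + 1)) ∧ v n = 1 ∧
    ∀ i, 1 ≤ i → i ≤ n →
      (1 - α) * (v i - v (i - 1))
        ≤ ∫ p in (v (i - 1))..(v i), ∑ x ∈ Finset.Icc i n, B n x p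

/-- A sequence `0 = l 0 < l 1 < ⋯ < l n < 1` of OLC lower endpoints at level `1 - α`. -/
def IsOLCLower (n : ℕ) (α : ℝ) (l : ℕ → ℝ) : Prop :=
  l 0 = 0 ∧ (∀ i, i < n → l i < l (i + 1)) ∧ l n < 1 ∧
    ∀ i, i < n →
      (∫ p in (l i)..(l (i + 1)), ∑ x ∈ Finset.range (i + 1), B n x p)
        = (1 - α) * (l (i + 1) - l i)

/-- A sequence `0 = l 0 < l 1 < ⋯ < l n < 1` giving lower-tail LCC intervals at level
`1 - α`. -/
def IsLCCLower (n : ℕ) (α : ℝ) (l : ℕ → ℝ) : Prop :=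
  l 0 = 0 ∧ (∀ i, i < n → l i < l (i + 1)) ∧ l n < 1 ∧
    ∀ i, i < n →
      (1 - α) * (l (i + 1) - l i)
        ≤ ∫ p in (l i)..(l (i + 1)), ∑ x ∈ Finset.range (i + 1), B n x p

/-- The coverage of an upper-tail endpoint sequence `w` at `p`:
`∑_{x=i}^n B(n,x,p)` where `i` is the smallest index with `p ≤ w i`. -/
noncomputable def cov (n : ℕ) (w : ℕ → ℝ) (p : ℝ) : ℝ :=
  ∑ x ∈ Finset.Icc (sInf {i : ℕ | p ≤ w i}) n, B n x p

/-- Clopper–Pearson upper endpoints at level `1 - α`: `u n = 1` and, for `i < n`,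
`u i ∈ (0,1)` solves `P(X ≤ i) = α` at `p = u i`. -/
def IsCPUpper (n : ℕ) (α : ℝ) (u : ℕ → ℝ) : Prop :=
  u n = 1 ∧ ∀ i, i < n → 0 < u i ∧ u i < 1 ∧
    ∑ x ∈ Finset.range (i + 1), B n x (u i) = α

lemma B_pos {n x : ℕ} (hx : x ≤ n) {p : ℝ} (hp0 : 0 < p) (hp1 : p < 1) : 0 < B n x p := by
  have hc : (0 : ℝ) < n.choose x := by exact_mod_cast Nat.choose_pos hx
  have hq : 0 < 1 - p := sub_pos.2 hp1
  unfold B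
  positivity

lemma sum_range_B (n : ℕ) (p : ℝ) : ∑ x ∈ Finset.range (n + 1), B n x p = 1 := by
  have h := add_pow p (1 - p) n
  rw [add_sub_cancel, one_pow] at h
  rw [h]
  refine Finset.sum_congr rfl fun x _ => ?_
  unfold B
  ring

lemma sum_Icc_B {n i : ℕ} (hi : i ≤ n) (p : ℝ) :
    ∑ x ∈ Finset.Icc i n, B n x p = 1 - ∑ x ∈ Finset.range i, B n x p := by
  rw [← sum_range_B n p, ← Finset.sum_range_add_sum_Ico (fun x => B n x p) (by omega : i ≤ n + 1),
    add_sub_cancel_left]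
  rfl

lemma continuous_B (n x : ℕ) : Continuous (B n x) := by
  unfold B
  fun_prop

/-- The derivative of the binomial distribution function in the success probability. -/
lemma hasDerivAt_sum_range_B {n i : ℕ} (hi : i < n) (p : ℝ) :
    HasDerivAt (fun q => ∑ x ∈ Finset.range (i + 1), B n x q)
      (-((n - i : ℝ) * n.choose i * p ^ i * (1 - p) ^ (n - 1 - i))) p := by
  have hq (k : ℕ) : HasDerivAt (fun q : ℝ => (1 - q) ^ k) (k * (1 - p) ^ (k - 1) * -1) p :=
    ((hasDerivAt_id p).const_sub 1).pow k
  induction i with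
  | zero =>
    simp only [zero_add, Finset.sum_range_one, B]
    convert hq n using 1
    · ext q
      simp
    · simp
  | succ i ih =>
    have hB : HasDerivAt (B n (i + 1))
        (n.choose (i + 1) * ((i + 1 : ℕ) * p ^ i) * (1 - p) ^ (n - (i + 1)) +
          n.choose (i + 1) * p ^ (i + 1) *
            ((n - (i + 1) : ℕ) * (1 - p) ^ (n - (i + 1) - 1) * -1)) p :=
      ((hasDerivAt_pow (i + 1) p).const_mul (n.choose (i + 1) : ℝ)).mul (hq (n - (i + 1)))
    have hsum := (ih (by omega)).add hB
    have hchoose : (n.choose (i + 1) : ℝ) * (i + 1) = n.choose i * (n - i) := by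
      have h := congrArg (Nat.cast (R := ℝ)) (Nat.choose_succ_right_eq n i)
      push_cast [Nat.cast_sub (by omega : i ≤ n)] at h
      exact h
    simp only [Finset.sum_range_succ _ (i + 1)]
    refine hsum.congr_deriv ?_
    rw [show n - 1 - i = n - (i + 1) by omega, show n - 1 - (i + 1) = n - (i + 1) - 1 by omega,
      Nat.cast_sub hi.le]
    push_cast
    linear_combination p ^ i * (1 - p) ^ (n - (i + 1)) * hchoose

lemma strictAntiOn_sum_range_B {n i : ℕ} (hi : i < n) :
    StrictAntiOn (fun q => ∑ x ∈ Finset.range (i + 1), B n x q) (Set.Icc 0 1) := by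
  refine strictAntiOn_of_deriv_neg (convex_Icc 0 1)
    (continuous_finsetSum _ fun x _ => continuous_B n x).continuousOn fun p hp => ?_
  rw [interior_Icc] at hp
  rw [(hasDerivAt_sum_range_B hi p).deriv, neg_lt_zero]
  have hc : (0 : ℝ) < n.choose i := by exact_mod_cast Nat.choose_pos hi.le
  have hni : (0 : ℝ) < n - i := sub_pos.2 (by exact_mod_cast hi)
  have hp0 : 0 < p := hp.1
  have hq : 0 < 1 - p := sub_pos.2 hp.2
  positivity

namespace IsCPUpper

variable {n : ℕ} {α : ℝ} {u : ℕ → ℝ}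

lemma mem_Ioc (hu : IsCPUpper n α u) {i : ℕ} (hi : i ≤ n) : u i ∈ Set.Ioc 0 1 := by
  rcases hi.eq_or_lt with rfl | hi
  · simp [hu.1]
  · exact ⟨(hu.2 i hi).1, (hu.2 i hi).2.1.le⟩

lemma lt_succ (hu : IsCPUpper n α u) {i : ℕ} (hi : i < n) : u i < u (i + 1) := by
  obtain ⟨h0, h1, hα⟩ := hu.2 i hi
  rcases (Nat.succ_le_of_lt hi).eq_or_lt with hin | hin
  · rwa [show i + 1 = n from hin, hu.1]
  · obtain ⟨h0', h1', hα'⟩ := hu.2 (i + 1) hin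
    refine ((strictAntiOn_sum_range_B hi).lt_iff_gt ⟨h0'.le, h1'.le⟩ ⟨h0.le, h1.le⟩).1 ?_
    rw [Finset.sum_range_succ] at hα'
    have := B_pos hin.le h0' h1'
    simp only [hα]
    linarith

lemma le_sum_Icc (hu : IsCPUpper n α u) {i : ℕ} (hi : i < n) {p : ℝ} (hp : u i ≤ p)
    (hp1 : p ≤ 1) : 1 - α ≤ ∑ x ∈ Finset.Icc (i + 1) n, B n x p := by
  obtain ⟨h0, h1, hα⟩ := hu.2 i hi
  rw [sum_Icc_B hi, ← hα]
  exact sub_le_sub_left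
    ((strictAntiOn_sum_range_B hi).antitoneOn ⟨h0.le, h1.le⟩ ⟨h0.le.trans hp, hp1⟩ hp) 1

lemma le_cov (hu : IsCPUpper n α u) (hα : 0 ≤ α) {p : ℝ} (hp1 : p ≤ 1) :
    1 - α ≤ cov n u p := by
  have hn : n ∈ {i : ℕ | p ≤ u i} := by simpa [hu.1] using hp1
  have hle := Nat.sInf_le hn
  unfold cov
  rcases h : sInf {i : ℕ | p ≤ u i} with _ | i
  · simpa [sum_Icc_B] using hα
  · refine hu.le_sum_Icc (by omega) (le_of_not_ge fun hp => ?_) hp1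
    have := Nat.sInf_le (s := {i : ℕ | p ≤ u i}) hp
    omega

lemma le_integral (hu : IsCPUpper n α u) {i : ℕ} (hi : i < n) :
    (1 - α) * (u (i + 1) - u i)
      ≤ ∫ p in (u i)..(u (i + 1)), ∑ x ∈ Finset.Icc (i + 1) n, B n x p := by
  have hcont : Continuous fun p => ∑ x ∈ Finset.Icc (i + 1) n, B n x p :=
    continuous_finsetSum _ fun x _ => continuous_B n x
  have h := intervalIntegral.integral_mono_on (μ := volume) (hu.lt_succ hi).le
    (intervalIntegrable_const (c := 1 - α)) (hcont.intervalIntegrable _ _)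
    fun p hp => hu.le_sum_Icc hi hp.1 (hp.2.trans (hu.mem_Ioc hi).2)
  rwa [intervalIntegral.integral_const, smul_eq_mul, mul_comm] at h

end IsCPUpper

theorem stmt_12 (n : ℕ) (hn : 1 ≤ n)
    (α : ℝ) (hα1 : 0 < α) (hα2 : α < 1)
    (u : ℕ → ℝ) (hu : IsCPUpper n α u) :
    (0 < u 0 ∧ (∀ i, i < n → u i < u (i + 1)) ∧ u n = 1) ∧
      (∀ p : ℝ, 0 < p → p ≤ 1 → 1 - α ≤ cov n u p) ∧
      ∀ i, 1 ≤ i → i ≤ n →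
        (1 - α) * (u i - u (i - 1))
          ≤ ∫ p in (u (i - 1))..(u i), ∑ x ∈ Finset.Icc i n, B n x p := by
  refine ⟨⟨(hu.mem_Ioc n.zero_le).1, fun i => hu.lt_succ, hu.1⟩,
    fun p _ => hu.le_cov hα1.le, fun i hi1 hin => ?_⟩
  obtain ⟨i, rfl⟩ := Nat.exists_eq_add_of_le' hi1
  exact hu.le_integral hin
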